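/- Let e ∈ ℝ with |e| < 1 and θ₀ ∈ ℝ, and let J(θ) = ∫_{θ₀}^{θ} 1/ρ(τ)² dτ (so J′(θ) = 1/ρ(θ)² and J(θ₀) = 0). Define x̃(θ) = 3 ρ(θ)² J(θ) and z̃(θ) = 2 − 3 e s(θ) J(θ). Then for all θ ∈ ℝ: x̃′(θ) = 3(1 − 2 e s(θ) J(θ)), z̃′(θ) = −3e (s′(θ) J(θ) + s(θ)/ρ(θ)²), and the pair (x̃, z̃) satisfies the in-plane Tschauner–Hempel system x̃″(θ) = 2 z̃′(θ) and z̃″(θ) = 3 z̃(θ)/ρ(θ) − 2 x̃′(θ). -/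

import Mathlib

noncomputable section

/-- `ρ(θ) = 1 + e cos θ`. -/
def ρ (e θ : ℝ) : ℝ := 1 + e * Real.cos θ

/-- `s(θ) = ρ(θ) sin θ`. -/
def s (e θ : ℝ) : ℝ := ρ e θ * Real.sin θ

/-- `s′(θ) = cos θ + e cos 2θ`. -/
def s' (e θ : ℝ) : ℝ := Real.cos θ + e * Real.cos (2 * θ)

/-- `J(θ) = ∫_{θ₀}^{θ} 1/ρ(τ)² dτ`. -/
def J (e θ₀ θ : ℝ) : ℝ := ∫ τ in θ₀..θ, 1 / (ρ e τ) ^ 2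

/-- Fourth column of the fundamental matrix: `x̃(θ) = 3ρ(θ)²J(θ)`. -/
def xt (e θ₀ θ : ℝ) : ℝ := 3 * (ρ e θ) ^ 2 * J e θ₀ θ

/-- Fourth column of the fundamental matrix: `z̃(θ) = 2 − 3es(θ)J(θ)`. -/
def zt (e θ₀ θ : ℝ) : ℝ := 2 - 3 * e * s e θ * J e θ₀ θ

lemma rho_pos {e : ℝ} (he : |e| < 1) (θ : ℝ) : 0 < ρ e θ := by
  have h : |e * Real.cos θ| < 1 := by
    rw [abs_mul]
    exact (mul_le_of_le_one_right (abs_nonneg e) (Real.abs_cos_le_one θ)).trans_lt he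
  unfold ρ
  linarith [neg_lt_of_abs_lt h]

lemma hasDerivAt_rho (e θ : ℝ) : HasDerivAt (ρ e) (-(e * Real.sin θ)) θ := by
  refine (((Real.hasDerivAt_cos θ).const_mul e).const_add 1).congr_deriv ?_
  ring

lemma hasDerivAt_s (e θ : ℝ) : HasDerivAt (s e) (s' e θ) θ := by
  refine ((hasDerivAt_rho e θ).mul (Real.hasDerivAt_sin θ)).congr_deriv ?_
  simp only [s', ρ, Real.cos_two_mul]
  linear_combination -e * Real.sin_sq_add_cos_sq θ

lemma hasDerivAt_s' (e θ : ℝ) :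
    HasDerivAt (s' e) (-Real.sin θ - 4 * e * Real.sin θ * Real.cos θ) θ := by
  have h := ((hasDerivAt_id θ).const_mul 2).cos.const_mul e
  refine ((Real.hasDerivAt_cos θ).add h).congr_deriv ?_
  simp only [id, Real.sin_two_mul]
  ring

lemma hasDerivAt_J {e : ℝ} (he : |e| < 1) (θ₀ θ : ℝ) :
    HasDerivAt (J e θ₀) (1 / (ρ e θ) ^ 2) θ := by
  have hρ : Continuous (ρ e) :=
    continuous_iff_continuousAt.2 fun t => (hasDerivAt_rho e t).continuousAt
  have hc : Continuous fun τ => 1 / (ρ e τ) ^ 2 :=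
    continuous_const.div (hρ.pow 2) fun t => pow_ne_zero 2 (rho_pos he t).ne'
  exact intervalIntegral.integral_hasDerivAt_right (hc.intervalIntegrable _ _)
    (hc.stronglyMeasurableAtFilter _ _) hc.continuousAt

lemma hasDerivAt_xt {e : ℝ} (he : |e| < 1) (θ₀ θ : ℝ) :
    HasDerivAt (xt e θ₀) (3 * (1 - 2 * e * s e θ * J e θ₀ θ)) θ := by
  have hne := (rho_pos he θ).ne'
  refine ((((hasDerivAt_rho e θ).pow 2).const_mul 3).mul
    (hasDerivAt_J he θ₀ θ)).congr_deriv ?_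
  simp only [s, Pi.pow_apply]
  field_simp
  ring

lemma hasDerivAt_zt {e : ℝ} (he : |e| < 1) (θ₀ θ : ℝ) :
    HasDerivAt (zt e θ₀)
      (-3 * e * (s' e θ * J e θ₀ θ + s e θ / (ρ e θ) ^ 2)) θ := by
  refine ((((hasDerivAt_s e θ).const_mul (3 * e)).mul
    (hasDerivAt_J he θ₀ θ)).const_sub 2).congr_deriv ?_
  ring

/-- The fourth column of `Φ_θ` solves the in-plane Tschauner–Hempel system,
with `J(θ₀) = 0`, `J′ = 1/ρ²`, `x̃′ = 3(1 − 2esJ)` and `z̃′ = −3e(s′J + s/ρ²)`. -/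
theorem fourth_column_solves_TH (e : ℝ) (he : |e| < 1) (θ₀ : ℝ) :
    J e θ₀ θ₀ = 0 ∧
    ∀ θ : ℝ,
      HasDerivAt (J e θ₀) (1 / (ρ e θ) ^ 2) θ ∧
      HasDerivAt (xt e θ₀) (3 * (1 - 2 * e * s e θ * J e θ₀ θ)) θ ∧
      HasDerivAt (zt e θ₀) (-3 * e * (s' e θ * J e θ₀ θ + s e θ / (ρ e θ) ^ 2)) θ ∧
      HasDerivAt (deriv (xt e θ₀)) (2 * deriv (zt e θ₀) θ) θ ∧
      HasDerivAt (deriv (zt e θ₀)) (3 * zt e θ₀ θ / ρ e θ - 2 * deriv (xt e θ₀) θ) θ := by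
  refine ⟨intervalIntegral.integral_same, fun θ => ⟨hasDerivAt_J he θ₀ θ,
    hasDerivAt_xt he θ₀ θ, hasDerivAt_zt he θ₀ θ, ?_, ?_⟩⟩
  · rw [funext fun t => (hasDerivAt_xt he θ₀ t).deriv, (hasDerivAt_zt he θ₀ θ).deriv]
    refine (((((hasDerivAt_s e θ).const_mul (2 * e)).mul
      (hasDerivAt_J he θ₀ θ)).const_sub 1).const_mul 3).congr_deriv ?_
    ring
  · rw [funext fun t => (hasDerivAt_zt he θ₀ t).deriv, (hasDerivAt_xt he θ₀ θ).deriv]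
    have hne := (rho_pos he θ).ne'
    refine ((((hasDerivAt_s' e θ).mul (hasDerivAt_J he θ₀ θ)).add
      ((hasDerivAt_s e θ).div ((hasDerivAt_rho e θ).pow 2)
        (pow_ne_zero 2 hne))).const_mul (-3 * e)).congr_deriv ?_
    have hs' : s' e θ = ρ e θ * Real.cos θ - e * Real.sin θ ^ 2 := by
      simp only [s', ρ, Real.cos_two_mul]
      linear_combination e * Real.sin_sq_add_cos_sq θ
    have hcos : e * Real.cos θ = ρ e θ - 1 := by simp [ρ]
    simp only [hs', zt, s, Pi.pow_apply]
    field_simp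
    linear_combination (4 * e * ρ e θ ^ 3 * Real.sin θ * J e θ₀ θ - 2 * ρ e θ ^ 2) * hcos
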